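/- Let D be an EAS division ring, m, n, p, q ≥ 2 be integers, and φ : M_{m×n}(D) → M_{p×q}(D) be an adjacency preserver such that φ([[A, 0],[0, 0]]) = [[A, 0],[0, 0]] for every A ∈ M_2(D) (the left block matrix being m×n, the right one p×q). Then m ≤ p, n ≤ q, and φ is standard. -/

import Mathlib

open Matrix

variable {D : Type*} [DivisionRing D]

/-- The rank of a matrix over a division ring: the dimension of its row space,
i.e. of the left `D`-subspace of `D^n` spanned by the rows. -/
noncomputable def rowRank {m n : ℕ} (A : Matrix (Fin m) (Fin n) D) : ℕ :=
  Module.finrank D (Submodule.span D (Set.range fun i => A i))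

/-- Two matrices are adjacent if their difference has rank one. -/
def Adjacent {m n : ℕ} (A B : Matrix (Fin m) (Fin n) D) : Prop :=
  rowRank (A - B) = 1

/-- `R(x)`: the set of matrices of the form `ᵗu x` for a fixed row vector `x`. -/
def Rvec {m n : ℕ} (x : Fin n → D) : Set (Matrix (Fin m) (Fin n) D) :=
  { M | ∃ u : Fin m → D, ∀ i j, M i j = u i * x j }

/-- `L(ᵗy)`: the set of matrices of the form `ᵗy v` for a fixed column vector `ᵗy`. -/
def Lvec {m n : ℕ} (y : Fin m → D) : Set (Matrix (Fin m) (Fin n) D) :=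
  { M | ∃ v : Fin n → D, ∀ i j, M i j = y i * v j }

/-- `R_d`: the matrices whose row space is contained in `d`. -/
def Rsub {m n : ℕ} (d : Submodule D (Fin n → D)) : Set (Matrix (Fin m) (Fin n) D) :=
  { M | ∀ i, M i ∈ d }

/-- `L_e`: the matrices whose column space (a right subspace, i.e. a `Dᵐᵒᵖ`-submodule)
is contained in `e`. -/
def Lsub {m n : ℕ} (e : Submodule Dᵐᵒᵖ (Fin m → D)) : Set (Matrix (Fin m) (Fin n) D) :=
  { M | ∀ j, (fun i => M i j) ∈ e }

/-- The orthogonal set of a set `e` of column vectors. -/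
def perpSet {m : ℕ} (e : Set (Fin m → D)) : Set (Fin m → D) :=
  { u | ∀ v ∈ e, ∑ i, u i * v i = 0 }

/-- The `p × q` matrix with upper-left block `B` and zeros elsewhere. -/
def pad {m n : ℕ} (p q : ℕ) (B : Matrix (Fin m) (Fin n) D) :
    Matrix (Fin p) (Fin q) D :=
  Matrix.of fun i j =>
    if hi : (i : ℕ) < m then if hj : (j : ℕ) < n then B ⟨i, hi⟩ ⟨j, hj⟩ else 0 else 0

/-- `φ` is degenerate with respect to `A`. -/
def DegenerateAt {m n p q : ℕ} (φ : Matrix (Fin m) (Fin n) D → Matrix (Fin p) (Fin q) D)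
    (A : Matrix (Fin m) (Fin n) D) : Prop :=
  ∃ x : Fin p → D, x ≠ 0 ∧ ∃ y : Fin q → D, y ≠ 0 ∧
    ∀ M : Matrix (Fin m) (Fin n) D, rowRank M ≤ 1 →
      φ (A + M) - φ A ∈ Rvec y ∪ Lvec x

/-- `φ` is degenerate: degenerate with respect to every matrix. -/
def Degenerate {m n p q : ℕ} (φ : Matrix (Fin m) (Fin n) D → Matrix (Fin p) (Fin q) D) :
    Prop :=
  ∀ A, DegenerateAt φ A

/-- A map (sending `0` to `0`) is degenerate with respect to `0` iff it maps every matrix of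
rank at most one into `R(y) ∪ L(ᵗx)` for some nonzero `y`, `x`. -/
def DegZero {m n p q : ℕ} (φ : Matrix (Fin m) (Fin n) D → Matrix (Fin p) (Fin q) D) :
    Prop :=
  ∃ x : Fin p → D, x ≠ 0 ∧ ∃ y : Fin q → D, y ≠ 0 ∧
    ∀ M : Matrix (Fin m) (Fin n) D, rowRank M ≤ 1 → φ M ∈ Rvec y ∪ Lvec x

/-- A standard adjacency preserver. -/
def Standard {m n p q : ℕ} (φ : Matrix (Fin m) (Fin n) D → Matrix (Fin p) (Fin q) D) :
    Prop :=
  (m ≤ p ∧ n ≤ q ∧ ∃ τ : D ≃+* D, ∃ T : Matrix (Fin p) (Fin p) D,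
    ∃ S : Matrix (Fin q) (Fin q) D, ∃ R : Matrix (Fin p) (Fin q) D,
    IsUnit T ∧ IsUnit S ∧ ∀ A, φ A = T * pad p q (A.map τ) * S + R) ∨
  (n ≤ p ∧ m ≤ q ∧ ∃ σ : D → D, Function.Bijective σ ∧ σ 1 = 1 ∧
    (∀ a b, σ (a + b) = σ a + σ b) ∧ (∀ a b, σ (a * b) = σ b * σ a) ∧
    ∃ T : Matrix (Fin p) (Fin p) D, ∃ S : Matrix (Fin q) (Fin q) D,
    ∃ R : Matrix (Fin p) (Fin q) D, IsUnit T ∧ IsUnit S ∧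
    ∀ A, φ A = T * pad p q (A.map σ).transpose * S + R)

/-- A division ring is EAS if every (unital) ring endomorphism of it is surjective. -/
def EAS (D : Type*) [DivisionRing D] : Prop :=
  ∀ f : D →+* D, Function.Surjective f

/-- A set of matrices is adjacent if any two distinct members are adjacent. -/
def IsAdjacentSet {m n : ℕ} (S : Set (Matrix (Fin m) (Fin n) D)) : Prop :=
  ∀ A ∈ S, ∀ B ∈ S, A ≠ B → Adjacent A B

/-- A matrix of rank one, as a nonzero product of a column by a row. -/
def IsRankOne {ι κ : Type*} (M : Matrix ι κ D) : Prop :=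
  M ≠ 0 ∧ ∃ a b, M = vecMulVec a b

/-- Right linear independence of two column vectors. -/
def RightIndep {ι : Type*} (a b : ι → D) : Prop :=
  ∀ s t : D, (∀ i, a i * s + b i * t = 0) → s = 0 ∧ t = 0

theorem RightIndep.symm {ι : Type*} {a b : ι → D} (h : RightIndep a b) : RightIndep b a :=
  fun s t hst => (h t s fun i => by rw [add_comm]; exact hst i).symm

theorem rightIndep_of_forall_ne {ι : Type*} {a b : ι → D} (ha : a ≠ 0)
    (hb : ∀ s, (fun i => a i * s) ≠ b) : RightIndep a b := by
  intro s t hst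
  have ht : t = 0 := by
    by_contra ht
    refine hb (-s * t⁻¹) (funext fun i => ?_)
    have : b i * t = -(a i * s) := eq_neg_of_add_eq_zero_right (hst i)
    rw [← mul_assoc, mul_neg, ← this, mul_assoc, mul_inv_cancel₀ ht, mul_one]
  subst ht
  refine ⟨?_, rfl⟩
  obtain ⟨i, hi⟩ := Function.ne_iff.1 ha
  exact (by simpa using hst i : a i = 0 ∨ s = 0).resolve_left hi

theorem exists_rightIndep {ι : Type*} [Nontrivial ι] {a : ι → D} (ha : a ≠ 0) :
    ∃ b, RightIndep a b := by
  classical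
  obtain ⟨i, hi⟩ := Function.ne_iff.1 ha
  obtain ⟨j, hj⟩ := exists_ne i
  refine ⟨Pi.single j 1, rightIndep_of_forall_ne ha fun s hs => ?_⟩
  have h1 : s = 0 :=
    (by simpa [hj.symm] using congrFun hs i : a i = 0 ∨ s = 0).resolve_left hi
  simpa [h1] using congrFun hs j

/-- If a matrix of rank at most one is a combination of two independent columns, then the two
coefficient rows are proportional. -/
theorem RightIndep.proportional {ι κ : Type*} {a a' : ι → D} (h : RightIndep a a')
    {b b' : κ → D} {c : ι → D} {d : κ → D}
    (he : vecMulVec a b + vecMulVec a' b' = vecMulVec c d) :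
    ∃ s s' : D, b = s • d ∧ b' = s' • d := by
  have he' : ∀ i j, a i * b j + a' i * b' j = c i * d j := fun i j => by
    simpa [vecMulVec_apply] using congrFun (congrFun he i) j
  by_cases hd : d = 0
  · refine ⟨0, 0, funext fun j => ?_, funext fun j => ?_⟩
    · simpa using (h (b j) (b' j) fun i => by simp [he', hd]).1
    · simpa using (h (b j) (b' j) fun i => by simp [he', hd]).2
  · obtain ⟨j₀, hj₀⟩ := Function.ne_iff.1 hd
    have hj₀ : d j₀ ≠ 0 := hj₀
    have key : ∀ j, b j - b j₀ * (d j₀)⁻¹ * d j = 0 ∧ b' j - b' j₀ * (d j₀)⁻¹ * d j = 0 := by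
      intro j
      refine h _ _ fun i => ?_
      have : c i * d j = (a i * b j₀ + a' i * b' j₀) * (d j₀)⁻¹ * d j := by
        rw [he', mul_inv_cancel_right₀ hj₀]
      rw [← he'] at this
      calc _ = (a i * b j + a' i * b' j) - (a i * b j₀ + a' i * b' j₀) * (d j₀)⁻¹ * d j := by
            noncomm_ring
        _ = 0 := by rw [this, sub_self]
    exact ⟨b j₀ * (d j₀)⁻¹, b' j₀ * (d j₀)⁻¹,
      funext fun j => by simpa using sub_eq_zero.1 (key j).1,
      funext fun j => by simpa using sub_eq_zero.1 (key j).2⟩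

theorem RightIndep.exists_smul_eq {ι κ : Type*} {a a' : ι → D} (h : RightIndep a a')
    {b b' : κ → D} {c : ι → D} {d : κ → D} (hb : b ≠ 0)
    (he : vecMulVec a b + vecMulVec a' b' = vecMulVec c d) :
    ∃ s : D, b' = s • b := by
  obtain ⟨s, s', rfl, rfl⟩ := h.proportional he
  have hs : s ≠ 0 := by rintro rfl; simp at hb
  exact ⟨s' * s⁻¹, by rw [smul_smul, inv_mul_cancel_right₀ hs]⟩

theorem RightIndep.mulVec {ι μ : Type*} [Fintype ι] {P : Matrix μ ι D}
    (hP : ∀ u, P *ᵥ u = 0 → u = 0) {a b : ι → D} (h : RightIndep a b) :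
    RightIndep (P *ᵥ a) (P *ᵥ b) := by
  intro s t hst
  refine h s t fun i => congrFun (hP (fun i => a i * s + b i * t) (funext fun j => ?_)) i
  have : (P *ᵥ fun i => a i * s + b i * t) j = (P *ᵥ a) j * s + (P *ᵥ b) j * t := by
    simp [Matrix.mulVec, dotProduct, mul_add, Finset.sum_add_distrib, Finset.sum_mul, mul_assoc]
  exact this.trans (hst j)

/-- A map sending `u ⊗ x`-directions to multiples of `x` is affine. -/
theorem exists_vecMul_of_rankOne_increments {ι κ : Type*} [Fintype ι] [Fintype κ] [Nontrivial κ]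
    (g : Matrix ι κ D → κ → D) (g0 : g 0 = 0)
    (hg : ∀ A u x, ∃ s : D, g (A + vecMulVec u x) = g A + s • x) :
    ∃ r : ι → D, ∀ A, g A = r ᵥ* A := by
  classical
  have hsum : ∀ (A C : Matrix ι κ D) (j : κ) (s : Finset κ), j ∉ s →
      g (C + ∑ i ∈ s, vecMulVec (A.col i) (Pi.single i 1)) j = g C j := by
    intro A C j s
    induction s using Finset.induction_on with
    | empty => simp
    | insert a s ha ih =>
      intro hj
      rw [Finset.mem_insert, not_or] at hj
      rw [Finset.sum_insert ha, add_comm (vecMulVec _ _), ← add_assoc]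
      obtain ⟨t, ht⟩ := hg (C + ∑ i ∈ s, vecMulVec (A.col i) (Pi.single i 1)) (A.col a)
        (Pi.single a 1)
      rw [ht]
      simp [hj.1, ih hj.2]
  have hcol : ∀ A j, g A j = g (vecMulVec (A.col j) (Pi.single j 1)) j := by
    intro A j
    rw [← hsum A (vecMulVec (A.col j) (Pi.single j 1)) j (Finset.univ.erase j) (by simp),
      Finset.add_sum_erase _ (fun i => vecMulVec (A.col i) (Pi.single i 1)) (Finset.mem_univ j)]
    congr 2
    ext i k
    simp [Matrix.sum_apply, vecMulVec_apply, Pi.single_apply]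
  set h : κ → (ι → D) → D := fun j u => g (vecMulVec u (Pi.single j 1)) j with hh
  have h0 : ∀ j, h j 0 = 0 := fun j => by simp [hh, g0]
  have hrel : ∀ i j, i ≠ j → ∀ (u v z : ι → D) (t : D),
      (h i (v + u) - h i v) * t = h j (z + fun a => u a * t) - h j z := by
    intro i j hij u v z t
    set A : Matrix ι κ D := vecMulVec v (Pi.single i 1) + vecMulVec z (Pi.single j 1) with hA
    obtain ⟨s, hs⟩ := hg A u (Pi.single i 1 + Pi.single j t)
    have hi := congrFun hs i
    have hj := congrFun hs j
    rw [hcol, Pi.add_apply, hcol A i] at hi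
    rw [hcol, Pi.add_apply, hcol A j] at hj
    have e1 : A.col i = v := by
      ext a; simp [hA, vecMulVec_apply, hij]
    have e2 : A.col j = z := by
      ext a; simp [hA, vecMulVec_apply, hij.symm]
    have e3 : (A + vecMulVec u (Pi.single i 1 + Pi.single j t)).col i = v + u := by
      ext a; simp [hA, vecMulVec_apply, hij]
    have e4 : (A + vecMulVec u (Pi.single i 1 + Pi.single j t)).col j = z + fun a => u a * t := by
      ext a; simp [hA, vecMulVec_apply, hij.symm]
    rw [e1, e3] at hi
    rw [e2, e4] at hj
    simp only [hh]
    rw [hi, hj]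
    simp [hij, hij.symm]
  have hmul : ∀ i j, i ≠ j → ∀ u t, h i u * t = h j (fun a => u a * t) := by
    intro i j hij u t
    simpa [h0] using hrel i j hij u 0 0 t
  have heq' : ∀ i j, i ≠ j → h i = h j := fun i j hij => funext fun u => by
    simpa using hmul i j hij u 1
  have heq : ∀ i j, h i = h j := fun i j => by
    by_cases hij : i = j
    · rw [hij]
    · exact heq' i j hij
  obtain ⟨i, j, hij⟩ := exists_pair_ne κ
  have hadd : ∀ u v, h i (v + u) = h i v + h i u := by
    intro u v
    have := hrel i j hij u v 0 1
    simp only [mul_one, zero_add, h0, sub_zero, ← heq i j] at this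
    rw [← this]; abel
  have hsmul : ∀ u t, h i (fun a => u a * t) = h i u * t := by
    intro u t
    rw [hmul i j hij, heq i j]
  refine ⟨fun a => h i (Pi.single a 1), fun A => funext fun b => ?_⟩
  rw [hcol]
  change h b (A.col b) = _
  rw [heq b i]
  let H : (ι → D) →+ D := ⟨⟨h i, h0 i⟩, fun u v => hadd v u⟩
  have hH : ∀ u, H u = h i u := fun _ => rfl
  rw [← hH, ← Finset.univ_sum_single (A.col b), map_sum]
  refine Finset.sum_congr rfl fun a _ => ?_
  rw [hH, ← hsmul]
  congr 1
  ext c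
  by_cases hc : c = a
  · subst hc; simp
  · simp [hc]

theorem RightIndep.ne_zero {ι : Type*} {a b : ι → D} (h : RightIndep a b) : a ≠ 0 := by
  rintro rfl
  exact one_ne_zero (h 1 0 fun i => by simp).1

theorem vecMulVec_zero_right {ι κ : Type*} (a : ι → D) : vecMulVec a (0 : κ → D) = 0 := by
  ext; simp [vecMulVec_apply]

theorem vecMulVec_ne_zero_of_ne {ι κ : Type*} {a : ι → D} {b : κ → D} (ha : a ≠ 0) (hb : b ≠ 0) :
    vecMulVec a b ≠ 0 := by
  obtain ⟨i, hi⟩ := Function.ne_iff.1 ha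
  obtain ⟨j, hj⟩ := Function.ne_iff.1 hb
  exact fun h => mul_ne_zero hi hj (congrFun (congrFun h i) j)

section ColumnExtension

variable {ι κ μ ν : Type*} [Fintype ι] [Fintype κ]

theorem exists_dotProduct_eq_zero [Nontrivial ι] (k : ι → D) : ∃ y : ι → D, y ≠ 0 ∧ k ⬝ᵥ y = 0 := by
  classical
  obtain ⟨i, j, hij⟩ := exists_pair_ne ι
  by_cases hi : k i = 0
  · exact ⟨Pi.single i 1, by simp, by simp [hi]⟩
  · refine ⟨Pi.single j 1 - Pi.single i ((k i)⁻¹ * k j), fun h0 => ?_, ?_⟩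
    · simpa [hij.symm] using congrFun h0 j
    · simp [dotProduct_sub, hi]

/-- Outside the line spanned by `c`, a nonzero row `k` takes the value `1 + k c`. -/
theorem exists_rightIndep_dotProduct [Nontrivial ι] {c k : ι → D} (hc : c ≠ 0) (hk : k ≠ 0) :
    ∃ d, RightIndep c d ∧ k ⬝ᵥ d = 1 + k ⬝ᵥ c := by
  classical
  have hmul : ∀ s, k ⬝ᵥ (fun i => c i * s) = k ⬝ᵥ c * s := fun s => by
    simp [dotProduct, Finset.sum_mul, mul_assoc]
  by_cases hkc : k ⬝ᵥ c = 0
  · obtain ⟨i, hi⟩ := Function.ne_iff.1 hk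
    have hi : k i ≠ 0 := hi
    refine ⟨Pi.single i (k i)⁻¹, rightIndep_of_forall_ne hc fun s hs => ?_, by simp [hi, hkc]⟩
    have := hmul s
    rw [hs, hkc] at this
    simp [hi] at this
  · obtain ⟨y, hy, hky⟩ := exists_dotProduct_eq_zero k
    refine ⟨(fun i => c i * ((k ⬝ᵥ c)⁻¹ * (1 + k ⬝ᵥ c))) + y,
      rightIndep_of_forall_ne hc fun s hs => hy ?_, ?_⟩
    · have h1 : y = fun i => c i * (s - (k ⬝ᵥ c)⁻¹ * (1 + k ⬝ᵥ c)) := by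
        funext i
        have := congrFun hs i
        simp only [Pi.add_apply] at this
        rw [mul_sub, this]; abel
      rw [h1, hmul] at hky
      have h2 := (mul_eq_zero.1 hky).resolve_left hkc
      rw [h1, h2]
      ext i; simp
    · rw [dotProduct_add, hky, hmul, mul_inv_cancel_left₀ hkc, add_zero]

theorem not_forall_vecMul_mem_line [Nontrivial κ] {Q : Matrix κ ν D}
    (hQ : ∀ v, v ᵥ* Q = 0 → v = 0) {b : ν → D}
    (h : ∀ x : κ → D, ∃ s : D, x ᵥ* Q = s • b) : False := by
  classical
  obtain ⟨i, j, hij⟩ := exists_pair_ne κ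
  obtain ⟨s, hs⟩ := h (Pi.single i 1)
  obtain ⟨t, ht⟩ := h (Pi.single j 1)
  have hs0 : s ≠ 0 := by
    rintro rfl
    exact one_ne_zero (Pi.single_eq_zero_iff.1 (hQ _ (by rw [hs, zero_smul])))
  have : Pi.single j 1 - (t * s⁻¹) • Pi.single i 1 = (0 : κ → D) := hQ _ (by
    rw [sub_vecMul, smul_vecMul, hs, ht, smul_smul, inv_mul_cancel_right₀ hs0, sub_self])
  simpa [hij.symm] using congrFun this j

theorem exists_eq_add_vecMulVec_of_adjacent [Nontrivial κ] {Q : Matrix κ ν D}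
    (hQ : ∀ v, v ᵥ* Q = 0 → v = 0) {Z : Matrix μ ν D} {c : μ → D} (hc : c ≠ 0)
    (hZ : ∀ x : κ → D, IsRankOne (Z - vecMulVec c (x ᵥ* Q))) :
    ∃ w : ν → D, Z = vecMulVec c w ∧ ∀ x, w ≠ x ᵥ* Q := by
  obtain ⟨hZ0, a, b, hab⟩ := hZ 0
  rw [zero_vecMul, vecMulVec_zero_right, sub_zero] at hZ0 hab
  subst hab
  have hb : b ≠ 0 := by rintro rfl; simp [vecMulVec_zero_right] at hZ0
  by_cases h : ∃ s, (fun i => c i * s) = a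
  · obtain ⟨s, rfl⟩ := h
    have hw : vecMulVec (fun i => c i * s) b = vecMulVec c (s • b) := by
      ext i j; simp [vecMulVec_apply, mul_assoc]
    refine ⟨s • b, hw, fun x hx => (hZ x).1 ?_⟩
    rw [hw, hx, sub_self]
  · push Not at h
    have hi := (rightIndep_of_forall_ne hc h).symm
    refine (not_forall_vecMul_mem_line (b := b) hQ fun x => ?_).elim
    obtain ⟨-, a', b', he⟩ := hZ x
    obtain ⟨s, hs⟩ := hi.exists_smul_eq hb (b' := -(x ᵥ* Q)) (c := a') (d := b') (by
      rw [← he, vecMulVec_neg, sub_eq_add_neg])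
    exact ⟨-s, by rw [neg_smul, ← hs, neg_neg]⟩

/-- An adjacency preserver of the form `A ↦ P A Q` on the matrices with zero last column has
this form everywhere, for some additional last row `w` of `Q`. -/
theorem exists_row_of_adjacency [Nontrivial ι] [Nontrivial κ] {P : Matrix μ ι D} {Q : Matrix κ ν D}
    (hP : ∀ u, P *ᵥ u = 0 → u = 0) (hQ : ∀ v, v ᵥ* Q = 0 → v = 0)
    (F : Matrix ι κ D → (ι → D) → Matrix μ ν D) (h0 : ∀ A, F A 0 = P * A * Q)
    (hF : ∀ A c u x t, u ≠ 0 → (x ≠ 0 ∨ t ≠ 0) →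
      IsRankOne (F (A + vecMulVec u x) (c + fun i => u i * t) - F A c)) :
    ∃ w : ν → D, (∀ x, w ≠ x ᵥ* Q) ∧ ∀ A c, F A c = P * A * Q + vecMulVec (P *ᵥ c) w := by
  have hP0 : ∀ u, u ≠ 0 → P *ᵥ u ≠ 0 := fun u hu h => hu (hP u h)
  have hQ0 : ∀ u, u ≠ 0 → u ᵥ* Q ≠ 0 := fun u hu h => hu (hQ u h)
  have hmv : ∀ u x, P * vecMulVec u x * Q = vecMulVec (P *ᵥ u) (x ᵥ* Q) := fun u x => by
    rw [mul_vecMulVec, vecMulVec_mul]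
  have exists_coeff : ∀ c, c ≠ 0 → ∀ A, ∃ w : ν → D,
      F A c = P * A * Q + vecMulVec (P *ᵥ c) w ∧ ∀ x, w ≠ x ᵥ* Q := by
    intro c hc A
    obtain ⟨w, hw, hw'⟩ := exists_eq_add_vecMulVec_of_adjacent hQ (Z := F A c - P * A * Q)
      (hP0 c hc) fun x => by
        have := hF (A + vecMulVec c x) 0 c (-x) 1 hc (Or.inr one_ne_zero)
        rw [h0, vecMulVec_neg, add_neg_cancel_right, Matrix.mul_add, Matrix.add_mul, hmv] at this
        simpa [sub_sub] using this
    exact ⟨w, by rw [← hw]; abel, hw'⟩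
  choose! w hw hwQ using exists_coeff
  have coeff_add_rankOne : ∀ c, c ≠ 0 → ∀ A u x,
      ∃ s : D, w c (A + vecMulVec u x) = w c A + (s • x) ᵥ* Q := by
    intro c hc
    have key : ∀ A u x, RightIndep u c →
        ∃ s : D, w c (A + vecMulVec u x) = w c A + (s • x) ᵥ* Q := by
      intro A u x hu
      by_cases hx : x = 0
      · exact ⟨0, by simp [hx, vecMulVec_zero_right]⟩
      obtain ⟨-, a, b, hab⟩ := hF A c u x 0 hu.ne_zero (Or.inl hx)
      have e : (c + fun i => u i * (0 : D)) = c := by ext; simp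
      rw [e, hw c hc, hw c hc, Matrix.mul_add, Matrix.add_mul, hmv] at hab
      obtain ⟨s, hs⟩ := (hu.mulVec hP).exists_smul_eq (hQ0 x hx)
        (b' := w c (A + vecMulVec u x) - w c A) (c := a) (d := b) (by
          rw [← hab, vecMulVec_sub]; abel)
      exact ⟨s, by rw [smul_vecMul, ← hs]; abel⟩
    intro A u x
    by_cases hu : ∃ s, (fun i => c i * s) = u
    · obtain ⟨s, rfl⟩ := hu
      obtain ⟨v, hv⟩ := exists_rightIndep hc
      have hv' : RightIndep ((fun i => c i * s) + v) c := fun a b hab => by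
        have := hv (s * a + b) a fun i => by
          rw [← hab i]; simp only [Pi.add_apply]; noncomm_ring
        simpa [this.2] using this.symm
      have hv'' : RightIndep (-v) c := fun a b hab => by
        simpa [and_comm] using hv b (-a) fun i => by rw [← hab i]; simp [add_comm]
      obtain ⟨a, ha⟩ := key A _ x hv'
      obtain ⟨b, hb⟩ := key (A + vecMulVec ((fun i => c i * s) + v) x) _ x hv''
      refine ⟨a + b, ?_⟩
      rw [add_assoc, ← add_vecMulVec, add_neg_cancel_right, ha] at hb
      rw [hb, add_smul, add_vecMul, add_assoc]
    · push Not at hu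
      exact key A u x (rightIndep_of_forall_ne hc hu).symm
  have exists_linear_part : ∀ c, c ≠ 0 → ∃ r : ι → D, ∀ A, w c A = w c 0 + (r ᵥ* A) ᵥ* Q := by
    classical
    intro c hc
    have hex : ∀ A, ∃ g : κ → D, w c A = w c 0 + g ᵥ* Q := by
      intro A
      have hs : ∀ s : Finset κ, ∃ g : κ → D,
          w c (∑ j ∈ s, vecMulVec (A.col j) (Pi.single j 1)) = w c 0 + g ᵥ* Q := by
        intro s
        induction s using Finset.induction_on with
        | empty => exact ⟨0, by simp⟩
        | insert a s ha ih =>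
          obtain ⟨g, hg⟩ := ih
          obtain ⟨t, ht⟩ := coeff_add_rankOne c hc
            (∑ j ∈ s, vecMulVec (A.col j) (Pi.single j 1)) (A.col a) (Pi.single a 1)
          refine ⟨g + t • Pi.single a 1, ?_⟩
          rw [Finset.sum_insert ha, add_comm, ht, hg, add_vecMul, add_assoc]
      convert hs Finset.univ
      ext i k
      simp [Matrix.sum_apply, vecMulVec_apply, Pi.single_apply]
    choose g hg using hex
    have hQinj : ∀ a b, a ᵥ* Q = b ᵥ* Q → a = b := fun a b hab =>
      sub_eq_zero.1 (hQ _ (by rw [sub_vecMul, hab, sub_self]))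
    obtain ⟨r, hr⟩ := exists_vecMul_of_rankOne_increments g
      (hQ _ (by simpa using (hg 0).symm)) fun A u x => by
        obtain ⟨s, hs⟩ := coeff_add_rankOne c hc A u x
        refine ⟨s, hQinj _ _ ?_⟩
        rw [hg, hg A, add_assoc, ← add_vecMul] at hs
        exact add_left_cancel hs
    exact ⟨r, fun A => by rw [hg, hr]⟩
  choose! k hk using exists_linear_part
  have coeff_proportional : ∀ c d, RightIndep c d →
      ∃ l : D, w d 0 = l • w c 0 ∧ k d = l • k c ∧ 1 + k d ⬝ᵥ (d - c) = l := by
    classical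
    intro c d hcd
    have hc := hcd.ne_zero
    have hd := hcd.symm.ne_zero
    have hdc : d - c ≠ 0 := fun h => by
      have := hcd 1 (-1) fun i => by
        have := congrFun h i
        simp only [Pi.sub_apply, Pi.zero_apply, sub_eq_zero] at this
        simp [this]
      exact one_ne_zero this.1
    have key : ∀ (A : Matrix ι κ D) (x : κ → D), ∃ l : D,
        w d 0 + (x + k d ᵥ* (A + vecMulVec (d - c) x)) ᵥ* Q =
          l • (w c 0 + (x + k c ᵥ* A) ᵥ* Q) := by
      intro A x
      obtain ⟨-, a, b, hab⟩ := hF A c (d - c) x 1 hdc (Or.inr one_ne_zero)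
      have e : (c + fun i => (d - c) i * (1 : D)) = d := by ext; simp
      rw [e, hw c hc, hw d hd, hk c hc A, hk d hd, Matrix.mul_add, Matrix.add_mul, hmv] at hab
      have hne : -(w c 0 + (x + k c ᵥ* A) ᵥ* Q) ≠ 0 := fun h => by
        refine hwQ c hc 0 (-(x + k c ᵥ* A)) ?_
        rw [neg_eq_zero] at h
        rw [neg_vecMul]
        exact eq_neg_of_add_eq_zero_left h
      obtain ⟨s, hs⟩ := (hcd.mulVec hP).exists_smul_eq hne
        (b' := w d 0 + (x + k d ᵥ* (A + vecMulVec (d - c) x)) ᵥ* Q) (c := a) (d := b) (by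
          rw [← hab, mulVec_sub, sub_vecMulVec (P *ᵥ d)]
          simp only [vecMulVec_add, vecMulVec_neg, add_vecMul]
          abel)
      exact ⟨-s, by rw [hs, smul_neg, neg_smul]⟩
    obtain ⟨l, hl⟩ := key 0 0
    simp only [vecMulVec_zero_right, add_zero, vecMul_zero, zero_vecMul] at hl
    have key' : ∀ (A : Matrix ι κ D) (x : κ → D),
        x + k d ᵥ* (A + vecMulVec (d - c) x) = l • (x + k c ᵥ* A) := by
      intro A x
      obtain ⟨l', hl'⟩ := key A x
      have hll : l' = l := by
        by_contra hne
        have hne := sub_ne_zero.2 hne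
        refine hwQ c hc 0 ((l' - l)⁻¹ •
          (x + k d ᵥ* (A + vecMulVec (d - c) x) - l' • (x + k c ᵥ* A))) ?_
        rw [smul_vecMul, eq_inv_smul_iff₀ hne, sub_vecMul, smul_vecMul, sub_smul, ← hl]
        rw [smul_add] at hl'
        rw [sub_eq_sub_iff_add_eq_add, ← hl', add_comm]
      subst hll
      rw [smul_add, hl, add_right_inj, ← smul_vecMul] at hl'
      exact sub_eq_zero.1 (hQ _ (by rw [sub_vecMul, hl', sub_self]))
    obtain ⟨j⟩ : Nonempty κ := inferInstance
    refine ⟨l, hl, funext fun i => ?_, ?_⟩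
    · have := congrFun (key' (Matrix.single i j 1) 0) j
      simpa [vecMulVec_zero_right, vecMul, dotProduct, Matrix.single_apply] using this
    · have := congrFun (key' 0 (Pi.single j 1)) j
      simpa [vecMul_vecMulVec] using this
  have hk0 : ∀ c, c ≠ 0 → k c = 0 := by
    intro c hc
    by_contra hkc
    obtain ⟨d, hcd, hd⟩ := exists_rightIndep_dotProduct hc hkc
    obtain ⟨l, -, h2, h3⟩ := coeff_proportional c d hcd
    rw [h2, smul_dotProduct, dotProduct_sub, hd] at h3
    simp at h3
  have hw0 : ∀ c d, RightIndep c d → w d 0 = w c 0 := by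
    intro c d hcd
    obtain ⟨l, h1, -, h3⟩ := coeff_proportional c d hcd
    rw [hk0 d hcd.symm.ne_zero, zero_dotProduct, add_zero] at h3
    rw [h1, ← h3, one_smul]
  obtain ⟨c₀, hc₀⟩ : ∃ c : ι → D, c ≠ 0 := exists_ne 0
  have hall : ∀ c, c ≠ 0 → w c 0 = w c₀ 0 := by
    intro c hc
    by_cases h : ∃ s, (fun i => c₀ i * s) = c
    · obtain ⟨s, rfl⟩ := h
      obtain ⟨v, hv⟩ := exists_rightIndep hc
      have hs : s ≠ 0 := by rintro rfl; exact hc (by ext; simp)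
      have hv' : RightIndep c₀ v := fun a b hab => by
        have := hv (s⁻¹ * a) b fun i => by rw [← hab i, mul_assoc, mul_inv_cancel_left₀ hs]
        simpa [hs] using this
      rw [← hw0 _ _ hv, hw0 _ _ hv']
    · push Not at h
      exact hw0 _ _ (rightIndep_of_forall_ne hc₀ h)
  refine ⟨w c₀ 0, hwQ c₀ hc₀ 0, fun A c => ?_⟩
  by_cases hc : c = 0
  · simp [hc, h0]
  · rw [hw c hc, hk c hc, hk0 c hc, zero_vecMul, zero_vecMul, add_zero, hall c hc]

end ColumnExtension

variable (D) in
/-- The rectangular matrix with ones on the main diagonal and zeros elsewhere. -/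
def rectOne (a b : ℕ) : Matrix (Fin a) (Fin b) D :=
  of fun i j => if (i : ℕ) = j then 1 else 0

theorem rectOne_mulVec_apply {a b : ℕ} (u : Fin b → D) (i : Fin a) :
    (rectOne D a b *ᵥ u) i = if h : (i : ℕ) < b then u ⟨i, h⟩ else 0 := by
  split_ifs with h
  · simp only [mulVec, dotProduct, rectOne, of_apply]
    rw [Finset.sum_eq_single ⟨i, h⟩] <;> simp +contextual [Fin.ext_iff, eq_comm]
  · simp only [mulVec, dotProduct, rectOne, of_apply]
    exact Finset.sum_eq_zero fun j _ => by rw [if_neg (by omega), zero_mul]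

theorem vecMul_rectOne_apply {a b : ℕ} (u : Fin a → D) (j : Fin b) :
    (u ᵥ* rectOne D a b) j = if h : (j : ℕ) < a then u ⟨j, h⟩ else 0 := by
  split_ifs with h
  · simp only [vecMul, dotProduct, rectOne, of_apply]
    rw [Finset.sum_eq_single ⟨j, h⟩] <;> simp +contextual [Fin.ext_iff]
  · simp only [vecMul, dotProduct, rectOne, of_apply]
    exact Finset.sum_eq_zero fun i _ => by rw [if_neg (by omega), mul_zero]

theorem rectOne_mulVec_eq_zero {a b : ℕ} (hab : b ≤ a) {u : Fin b → D}
    (hu : rectOne D a b *ᵥ u = 0) : u = 0 := by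
  ext j
  simpa [rectOne_mulVec_apply] using congrFun hu (Fin.castLE hab j)

theorem vecMul_rectOne_eq_zero {a b : ℕ} (hab : a ≤ b) {u : Fin a → D}
    (hu : u ᵥ* rectOne D a b = 0) : u = 0 := by
  ext j
  simpa [vecMul_rectOne_apply] using congrFun hu (Fin.castLE hab j)

theorem rectOne_self (a : ℕ) : rectOne D a a = 1 := by
  ext i j
  simp [rectOne, one_apply, Fin.ext_iff]

theorem pad_eq_mul {m n : ℕ} (p q : ℕ) (B : Matrix (Fin m) (Fin n) D) :
    pad p q B = rectOne D p m * B * rectOne D n q := by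
  ext i j
  have h1 : (rectOne D p m * B * rectOne D n q) i j =
      ((rectOne D p m * B) i ᵥ* rectOne D n q) j := rfl
  have h2 : ∀ k, (rectOne D p m * B) i k = (rectOne D p m *ᵥ B.col k) i := fun _ => rfl
  rw [h1, vecMul_rectOne_apply]
  simp only [h2, rectOne_mulVec_apply, pad, of_apply, col_apply]
  split_ifs <;> rfl

theorem rowRank_eq_one_iff {m n : ℕ} (A : Matrix (Fin m) (Fin n) D) :
    rowRank A = 1 ↔ IsRankOne A := by
  constructor
  · intro h
    refine ⟨?_, ?_⟩
    · rintro rfl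
      have : Submodule.span D (Set.range fun i => (0 : Matrix (Fin m) (Fin n) D) i) = ⊥ := by
        rw [Submodule.span_eq_bot]
        rintro _ ⟨i, rfl⟩
        rfl
      rw [rowRank, this, finrank_bot] at h
      exact zero_ne_one h
    · obtain ⟨v, -, hv⟩ := finrank_eq_one_iff'.1 h
      choose c hc using fun i => hv ⟨A i, Submodule.subset_span ⟨i, rfl⟩⟩
      refine ⟨c, v, ?_⟩
      ext i j
      exact (congrFun (congrArg Subtype.val (hc i)) j).symm
  · rintro ⟨h0, a, b, rfl⟩
    have hb : b ≠ 0 := by rintro rfl; exact h0 (vecMulVec_zero_right a)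
    obtain ⟨i, hi⟩ := Function.ne_iff.1 (show a ≠ 0 by rintro rfl; exact h0 (zero_vecMulVec b))
    have hi : a i ≠ 0 := hi
    have : Submodule.span D (Set.range fun i => vecMulVec a b i) = Submodule.span D {b} := by
      apply le_antisymm
      · rw [Submodule.span_le]
        rintro _ ⟨j, rfl⟩
        exact Submodule.mem_span_singleton.2 ⟨a j, rfl⟩
      · rw [Submodule.span_singleton_le_iff_mem]
        have := Submodule.smul_mem _ (a i)⁻¹
          (Submodule.subset_span (R := D) (s := Set.range fun i => vecMulVec a b i) ⟨i, rfl⟩)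
        convert this
        ext j
        simp [vecMulVec_apply, hi]
    rw [rowRank, this, finrank_span_singleton hb]

/-- The map is `A ↦ P A Q`, with `P` and `Q` injective, on the matrices supported in the upper-left
block of size `l × k`. -/
def HasFormOnCorner {m n p q : ℕ} (φ : Matrix (Fin m) (Fin n) D → Matrix (Fin p) (Fin q) D)
    (l k : ℕ) : Prop :=
  ∃ (P : Matrix (Fin p) (Fin l) D) (Q : Matrix (Fin k) (Fin q) D),
    (∀ u, P *ᵥ u = 0 → u = 0) ∧ (∀ v, v ᵥ* Q = 0 → v = 0) ∧
    ∀ A : Matrix (Fin l) (Fin k) D, φ (rectOne D m l * A * rectOne D k n) = P * A * Q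

theorem HasFormOnCorner.succ_right {m n p q l k : ℕ}
    {φ : Matrix (Fin m) (Fin n) D → Matrix (Fin p) (Fin q) D}
    (hφ : ∀ A B, IsRankOne (A - B) → IsRankOne (φ A - φ B)) (hl : 2 ≤ l) (hk : 2 ≤ k)
    (hlm : l ≤ m) (hkn : k + 1 ≤ n) (h : HasFormOnCorner φ l k) : HasFormOnCorner φ l (k + 1) := by
  obtain ⟨P, Q, hP, hQ, hPQ⟩ := h
  have : Nontrivial (Fin l) := Fin.nontrivial_iff_two_le.2 hl
  have : Nontrivial (Fin k) := Fin.nontrivial_iff_two_le.2 hk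
  set e : Fin n → D := Pi.single ⟨k, hkn⟩ 1 with he
  obtain ⟨w, hwQ, hw⟩ := exists_row_of_adjacency hP hQ
    (fun A c => φ (rectOne D m l * A * rectOne D k n + vecMulVec (rectOne D m l *ᵥ c) e))
    (fun A => by rw [mulVec_zero, zero_vecMulVec, add_zero, hPQ])
    fun A c u x t hu hxt => hφ _ _ <| by
      have h1 : (rectOne D m l *ᵥ fun i => u i * t) = fun i => (rectOne D m l *ᵥ u) i * t := by
        ext i; simp [mulVec, dotProduct, Finset.sum_mul, mul_assoc]
      have h2 : vecMulVec (fun i => (rectOne D m l *ᵥ u) i * t) e =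
          vecMulVec (rectOne D m l *ᵥ u) (t • e) := by
        ext i j; simp [vecMulVec_apply, mul_assoc]
      have h3 : rectOne D m l * (A + vecMulVec u x) * rectOne D k n +
          vecMulVec (rectOne D m l *ᵥ (c + fun i => u i * t)) e -
          (rectOne D m l * A * rectOne D k n + vecMulVec (rectOne D m l *ᵥ c) e) =
          vecMulVec (rectOne D m l *ᵥ u) (x ᵥ* rectOne D k n + t • e) := by
        rw [Matrix.mul_add, Matrix.add_mul, mul_vecMulVec, vecMulVec_mul, mulVec_add,
          add_vecMulVec, h1, h2, vecMulVec_add]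
        abel
      rw [h3]
      refine ⟨vecMulVec_ne_zero_of_ne (fun h => hu (rectOne_mulVec_eq_zero hlm h)) fun h => ?_,
        _, _, rfl⟩
      have ht : t = 0 := by
        simpa [vecMul_rectOne_apply, he] using congrFun h ⟨k, hkn⟩
      rw [ht, zero_smul, add_zero] at h
      exact hxt.elim (fun hx => hx (vecMul_rectOne_eq_zero (by omega) h)) fun h => h ht
  obtain ⟨Q', hQ'₁, hQ'₂⟩ : ∃ Q' : Matrix (Fin (k + 1)) (Fin q) D,
      (∀ i j, Q' i.castSucc j = Q i j) ∧ ∀ j, Q' (Fin.last k) j = w j :=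
    ⟨of fun i j => Fin.snoc (α := fun _ => D) (fun i => Q i j) (w j) i,
      fun i j => by simp, fun j => by simp⟩
  refine ⟨P, Q', hP, fun v hv => ?_, fun A => ?_⟩
  · have hv' : (fun i : Fin k => v i.castSucc) ᵥ* Q + v (Fin.last k) • w = 0 := by
      rw [← hv]
      ext j
      simp [vecMul, dotProduct, Fin.sum_univ_castSucc, hQ'₁, hQ'₂]
    have h0 : v (Fin.last k) = 0 := by
      by_contra h0
      refine hwQ (-(v (Fin.last k))⁻¹ • fun i : Fin k => v i.castSucc) ?_
      rw [smul_vecMul, eq_neg_of_add_eq_zero_left hv', smul_neg, neg_smul, neg_neg, smul_smul,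
        inv_mul_cancel₀ h0, one_smul]
    rw [h0, zero_smul, add_zero] at hv'
    have h1 := hQ _ hv'
    ext i
    refine Fin.lastCases h0 (fun i => congrFun h1 i) i
  · have hA : rectOne D m l * A * rectOne D (k + 1) n =
        rectOne D m l * (A.submatrix id Fin.castSucc) * rectOne D k n +
          vecMulVec (rectOne D m l *ᵥ A.col (Fin.last k)) e := by
      ext i j
      simp only [Matrix.add_apply, vecMulVec_apply]
      rw [Matrix.mul_apply, Matrix.mul_apply, Fin.sum_univ_castSucc]
      congr 1
      simp [rectOne, he, Pi.single_apply, Fin.ext_iff, mul_apply, mulVec, dotProduct, eq_comm]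
    rw [hA, hw (A.submatrix id Fin.castSucc) (A.col (Fin.last k))]
    ext i j
    simp only [Matrix.add_apply, vecMulVec_apply]
    rw [Matrix.mul_apply, Matrix.mul_apply, Fin.sum_univ_castSucc]
    simp [mul_apply, mulVec, dotProduct, hQ'₁, hQ'₂]

theorem HasFormOnCorner.full_right {m n p q l k : ℕ}
    {φ : Matrix (Fin m) (Fin n) D → Matrix (Fin p) (Fin q) D}
    (hφ : ∀ A B, IsRankOne (A - B) → IsRankOne (φ A - φ B)) (hl : 2 ≤ l) (hk : 2 ≤ k)
    (hlm : l ≤ m) (hkn : k ≤ n) (h : HasFormOnCorner φ l k) : HasFormOnCorner φ l n := by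
  suffices ∀ j, k ≤ j → j ≤ n → HasFormOnCorner φ l j from this n hkn le_rfl
  intro j hj
  induction j, hj using Nat.le_induction with
  | base => exact fun _ => h
  | succ j hj ih => exact fun hjn => (ih (by omega)).succ_right hφ hl (hk.trans hj) hlm hjn

/-- The transpose, as a matrix over the opposite ring. -/
def opTranspose {R ι κ : Type*} : Matrix ι κ R ≃ Matrix κ ι Rᵐᵒᵖ where
  toFun A := of fun i j => MulOpposite.op (A j i)
  invFun A := of fun i j => (A j i).unop
  left_inv _ := rfl
  right_inv _ := rfl

@[simp]
theorem opTranspose_apply {R ι κ : Type*} (A : Matrix ι κ R) (i : κ) (j : ι) :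
    opTranspose A i j = MulOpposite.op (A j i) := rfl

@[simp]
theorem opTranspose_symm_apply {R ι κ : Type*} (A : Matrix κ ι Rᵐᵒᵖ) (i : ι) (j : κ) :
    opTranspose.symm A i j = (A j i).unop := rfl

theorem opTranspose_mul {ι κ μ : Type*} [Fintype κ] (A : Matrix ι κ D) (B : Matrix κ μ D) :
    opTranspose (A * B) = opTranspose B * opTranspose A := by
  ext i j
  simp [mul_apply]

theorem opTranspose_rectOne (a b : ℕ) : opTranspose (rectOne D a b) = rectOne Dᵐᵒᵖ b a := by
  ext i j
  by_cases h : (i : ℕ) = j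
  · simp [rectOne, h]
  · simp [rectOne, h, Ne.symm h]

theorem opTranspose_mulVec_eq_zero {ι κ : Type*} [Fintype ι] {Q : Matrix ι κ D}
    (hQ : ∀ v, v ᵥ* Q = 0 → v = 0) (u : ι → Dᵐᵒᵖ) (hu : opTranspose Q *ᵥ u = 0) : u = 0 := by
  have := hQ (fun i => (u i).unop) (funext fun j => by
    have := congrArg MulOpposite.unop (congrFun hu j)
    simpa [mulVec, vecMul, dotProduct] using this)
  exact funext fun i => MulOpposite.unop_injective (congrFun this i)

theorem vecMul_opTranspose_eq_zero {ι κ : Type*} [Fintype κ] {P : Matrix ι κ D}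
    (hP : ∀ v, P *ᵥ v = 0 → v = 0) (u : κ → Dᵐᵒᵖ) (hu : u ᵥ* opTranspose P = 0) : u = 0 := by
  have := hP (fun i => (u i).unop) (funext fun j => by
    have := congrArg MulOpposite.unop (congrFun hu j)
    simpa [mulVec, vecMul, dotProduct] using this)
  exact funext fun i => MulOpposite.unop_injective (congrFun this i)

theorem isRankOne_opTranspose {ι κ : Type*} {A : Matrix ι κ D} :
    IsRankOne (opTranspose A) ↔ IsRankOne A := by
  refine and_congr (not_congr (opTranspose.apply_eq_iff_eq (y := 0))) ⟨?_, ?_⟩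
  · rintro ⟨a, b, h⟩
    refine ⟨fun i => (b i).unop, fun j => (a j).unop, ?_⟩
    ext i j
    exact congrArg MulOpposite.unop (congrFun (congrFun h j) i)
  · rintro ⟨a, b, rfl⟩
    exact ⟨fun i => MulOpposite.op (b i), fun j => MulOpposite.op (a j), rfl⟩


/-- The map induced on matrices over the opposite ring by transposition. -/
def opConj {m n p q : ℕ} (φ : Matrix (Fin m) (Fin n) D → Matrix (Fin p) (Fin q) D)
    (A : Matrix (Fin n) (Fin m) Dᵐᵒᵖ) : Matrix (Fin q) (Fin p) Dᵐᵒᵖ :=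
  opTranspose (φ (opTranspose.symm A))

theorem isRankOne_opConj_sub {m n p q : ℕ} {φ : Matrix (Fin m) (Fin n) D → Matrix (Fin p) (Fin q) D}
    (hφ : ∀ A B, IsRankOne (A - B) → IsRankOne (φ A - φ B)) (A B : Matrix (Fin n) (Fin m) Dᵐᵒᵖ)
    (h : IsRankOne (A - B)) : IsRankOne (opConj φ A - opConj φ B) :=
  isRankOne_opTranspose.2 (hφ _ _ (isRankOne_opTranspose.1 h))

theorem hasFormOnCorner_opConj {m n p q l k : ℕ}
    {φ : Matrix (Fin m) (Fin n) D → Matrix (Fin p) (Fin q) D} (h : HasFormOnCorner φ l k) :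
    HasFormOnCorner (opConj φ) k l := by
  obtain ⟨P, Q, hP, hQ, hPQ⟩ := h
  refine ⟨opTranspose Q, opTranspose P, opTranspose_mulVec_eq_zero hQ,
    vecMul_opTranspose_eq_zero hP, fun A => ?_⟩
  obtain ⟨A, rfl⟩ := opTranspose.surjective A
  have : rectOne Dᵐᵒᵖ n k * opTranspose A * rectOne Dᵐᵒᵖ l m =
      opTranspose (rectOne D m l * A * rectOne D k n) := by
    rw [opTranspose_mul, opTranspose_mul, opTranspose_rectOne, opTranspose_rectOne,
      Matrix.mul_assoc]
  rw [this, opConj, Equiv.symm_apply_apply, hPQ, opTranspose_mul, opTranspose_mul, Matrix.mul_assoc]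

theorem opTranspose_symm_mul {ι κ μ : Type*} [Fintype κ] (A : Matrix ι κ Dᵐᵒᵖ)
    (B : Matrix κ μ Dᵐᵒᵖ) :
    opTranspose.symm (A * B) = opTranspose.symm B * opTranspose.symm A := by
  apply opTranspose.injective
  rw [opTranspose_mul]
  simp

/-- An injective matrix acting on rows is the top part of an invertible square matrix. -/
theorem exists_rectOne_mul_eq {n q : ℕ} {Q : Matrix (Fin n) (Fin q) D}
    (hQ : ∀ v, v ᵥ* Q = 0 → v = 0) :
    n ≤ q ∧ ∃ S : Matrix (Fin q) (Fin q) D, IsUnit S ∧ rectOne D n q * S = Q := by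
  let f : (Fin n → D) →ₗ[D] (Fin q → D) :=
    { toFun := fun v => v ᵥ* Q
      map_add' := fun a b => add_vecMul _ _ _
      map_smul' := fun a b => smul_vecMul _ _ _ }
  let g : (Fin n → D) →ₗ[D] (Fin q → D) :=
    { toFun := fun v => v ᵥ* rectOne D n q
      map_add' := fun a b => add_vecMul _ _ _
      map_smul' := fun a b => smul_vecMul _ _ _ }
  have hf : Function.Injective f := (injective_iff_map_eq_zero f).2 hQ
  have hnq : n ≤ q := by simpa using LinearMap.finrank_le_finrank_of_injective hf
  have hg : Function.Injective g :=
    (injective_iff_map_eq_zero g).2 fun v => vecMul_rectOne_eq_zero hnq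
  refine ⟨hnq, ?_⟩
  obtain ⟨s, hs⟩ := Submodule.exists_linearEquiv_restrict_eq
    ((LinearEquiv.ofInjective g hg).symm ≪≫ₗ LinearEquiv.ofInjective f hf)
  have hs' : ∀ v, s (v ᵥ* rectOne D n q) = v ᵥ* Q := fun v => by
    have := hs (LinearEquiv.ofInjective g hg v)
    simpa [f, g] using this.symm
  have hmat : ∀ (t : (Fin q → D) ≃ₗ[D] (Fin q → D)) v,
      v ᵥ* (of fun i => t (Pi.single i 1)) = t v := fun t v => by
    conv_rhs => rw [← Finset.univ_sum_single v, map_sum]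
    ext j
    simp only [vecMul, dotProduct, of_apply, Finset.sum_apply]
    refine Finset.sum_congr rfl fun i _ => ?_
    have : (Pi.single i (v i) : Fin q → D) = v i • Pi.single i 1 := by
      rw [← Pi.single_smul, smul_eq_mul, mul_one]
    rw [this, map_smul, Pi.smul_apply, smul_eq_mul]
  have hext : ∀ {a b : ℕ} (A B : Matrix (Fin a) (Fin b) D), (∀ v, v ᵥ* A = v ᵥ* B) → A = B :=
    fun A B h => by
      ext i j
      simpa using congrFun (h (Pi.single i 1)) j
  have hinv : ∀ t : (Fin q → D) ≃ₗ[D] (Fin q → D),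
      (of fun i => t (Pi.single i 1)) * (of fun i => t.symm (Pi.single i 1)) =
        (1 : Matrix (Fin q) (Fin q) D) := fun t =>
    hext _ _ fun v => by rw [← vecMul_vecMul, hmat, hmat, t.symm_apply_apply, vecMul_one]
  refine ⟨of fun i => s (Pi.single i 1), ⟨⟨_, _, hinv s, hinv s.symm⟩, rfl⟩, ?_⟩
  exact hext _ _ fun v => by rw [← vecMul_vecMul, hmat, hs']

theorem exists_mul_rectOne_eq {m p : ℕ} {P : Matrix (Fin p) (Fin m) D}
    (hP : ∀ v, P *ᵥ v = 0 → v = 0) :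
    m ≤ p ∧ ∃ T : Matrix (Fin p) (Fin p) D, IsUnit T ∧ T * rectOne D p m = P := by
  obtain ⟨h, S, ⟨⟨S, S', h1, h2⟩, rfl⟩, hS⟩ := exists_rectOne_mul_eq (vecMul_opTranspose_eq_zero hP)
  have hone : opTranspose.symm (1 : Matrix (Fin p) (Fin p) Dᵐᵒᵖ) = 1 := by
    rw [← rectOne_self, ← opTranspose_rectOne, Equiv.symm_apply_apply, rectOne_self]
  refine ⟨h, opTranspose.symm S, ⟨⟨_, opTranspose.symm S', ?_, ?_⟩, rfl⟩, ?_⟩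
  · rw [← opTranspose_symm_mul, h2, hone]
  · rw [← opTranspose_symm_mul, h1, hone]
  · apply opTranspose.injective
    rw [opTranspose_mul, Equiv.apply_symm_apply, opTranspose_rectOne]
    exact hS

theorem HasFormOnCorner.standard {m n p q : ℕ}
    {φ : Matrix (Fin m) (Fin n) D → Matrix (Fin p) (Fin q) D} (h : HasFormOnCorner φ m n) :
    m ≤ p ∧ n ≤ q ∧ Standard φ := by
  obtain ⟨P, Q, hP, hQ, hPQ⟩ := h
  obtain ⟨hmp, T, hT, rfl⟩ := exists_mul_rectOne_eq hP
  obtain ⟨hnq, S, hS, rfl⟩ := exists_rectOne_mul_eq hQ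
  refine ⟨hmp, hnq, Or.inl ⟨hmp, hnq, RingEquiv.refl D, T, S, 0, hT, hS, fun A => ?_⟩⟩
  have hA : A.map (RingEquiv.refl D) = A := rfl
  have := hPQ A
  rw [rectOne_self, rectOne_self, Matrix.one_mul, Matrix.mul_one] at this
  rw [this, hA, pad_eq_mul, add_zero]
  simp only [Matrix.mul_assoc]

/-- Proposition 3.13. -/
theorem stmt14 (hEAS : EAS D) (m n p q : ℕ) (hm : 2 ≤ m) (hn : 2 ≤ n) (hp : 2 ≤ p)
    (hq : 2 ≤ q)
    (φ : Matrix (Fin m) (Fin n) D → Matrix (Fin p) (Fin q) D)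
    (hφ : ∀ A B, Adjacent A B → Adjacent (φ A) (φ B))
    (h : ∀ A : Matrix (Fin 2) (Fin 2) D, φ (pad m n A) = pad p q A) :
    m ≤ p ∧ n ≤ q ∧ Standard φ := by
  have hφ' : ∀ A B, IsRankOne (A - B) → IsRankOne (φ A - φ B) := fun A B hAB =>
    (rowRank_eq_one_iff _).1 (hφ A B ((rowRank_eq_one_iff _).2 hAB))
  have h₂ : HasFormOnCorner φ 2 2 :=
    ⟨rectOne D p 2, rectOne D 2 q, fun _ => rectOne_mulVec_eq_zero hp,
      fun _ => vecMul_rectOne_eq_zero hq, fun A => by rw [← pad_eq_mul, h, pad_eq_mul]⟩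
  have h₃ : HasFormOnCorner (opConj φ) n m :=
    (hasFormOnCorner_opConj (h₂.full_right hφ' le_rfl le_rfl hm hn)).full_right
      (isRankOne_opConj_sub hφ') hn le_rfl le_rfl hm
  obtain ⟨P, Q, hP, hQ, hPQ⟩ := h₃
  refine HasFormOnCorner.standard ⟨opTranspose.symm Q, opTranspose.symm P, fun u hu => ?_,
    fun v hv => ?_, fun A => opTranspose.injective ?_⟩
  · have := hQ (fun i => MulOpposite.op (u i)) (funext fun j => by
      have := congrArg MulOpposite.op (congrFun hu j)
      simpa [mulVec, vecMul, dotProduct] using this)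
    exact funext fun i => MulOpposite.op_injective (congrFun this i)
  · have := hP (fun i => MulOpposite.op (v i)) (funext fun j => by
      have := congrArg MulOpposite.op (congrFun hv j)
      simpa [mulVec, vecMul, dotProduct] using this)
    exact funext fun i => MulOpposite.op_injective (congrFun this i)
  · have := hPQ (opTranspose A)
    rw [rectOne_self, rectOne_self, Matrix.one_mul, Matrix.mul_one, opConj,
      Equiv.symm_apply_apply] at this
    rw [rectOne_self, rectOne_self, Matrix.one_mul, Matrix.mul_one, this, opTranspose_mul,
      opTranspose_mul, Equiv.apply_symm_apply, Equiv.apply_symm_apply, Matrix.mul_assoc]
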